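/- arXiv:2105.01242 — 2 statements merged into one kernel-verified Lean document; each statement's English description precedes it below -/
import Mathlib

section
/- Let D and R be natural numbers with 4 ≤ D ≤ R, and let f : Fin D → Fin R be chosen uniformly at random from all functions. Then the probability that f has exactly one collision pair is at least (D(D−1)/(2R)) · (1 − (D−2)/R) · (1 − (D−2)(D−3)/(2(R−1))). -/
open scoped Classical

/-- A collision pair of `f` is an unordered pair `{x,y}` with `x ≠ y` and `f x = f y`,
i.e. a non-diagonal element of `Sym2 (Fin D)` whose image under `f` is diagonal. -/
noncomputable def collisionPairs {D R : ℕ} (f : Fin D → Fin R) : Finset (Sym2 (Fin D)) :=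
  Finset.univ.filter (fun s => ¬ s.IsDiag ∧ (s.map f).IsDiag)

/-- A function obtained from an injection on `{x // x ≠ b}` by giving `b` the value of `a ≠ b`
has `{a, b}` as its only collision pair. -/
lemma collisionPairs_extend {D R : ℕ} {a b : Fin D} (hab : a ≠ b)
    (g : {x : Fin D // x ≠ b} ↪ Fin R) :
    collisionPairs (fun x => if h : x = b then g ⟨a, hab⟩ else g ⟨x, h⟩) = {s(a, b)} := by
  ext s
  induction s using Sym2.ind with
  | _ x y =>
    simp only [collisionPairs, Finset.mem_filter, Finset.mem_univ, true_and,
      Finset.mem_singleton, Sym2.map_mk, Sym2.mk_isDiag_iff, Sym2.eq_iff]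
    by_cases hx : x = b <;> by_cases hy : y = b <;>
      simp [hx, hy, g.injective.eq_iff] <;> grind

lemma descFactorial_le_card_collisionPairs_eq {D R : ℕ} {s : Sym2 (Fin D)} (hs : ¬ s.IsDiag) :
    R.descFactorial (D - 1) ≤
      (Finset.univ.filter (fun f : Fin D → Fin R => collisionPairs f = {s})).card := by
  induction s using Sym2.ind with
  | _ a b =>
    have hab : a ≠ b := by simpa using hs
    have hc : Fintype.card ({x : Fin D // x ≠ b} ↪ Fin R) = R.descFactorial (D - 1) := by
      rw [Fintype.card_embedding_eq, Fintype.card_fin, Fintype.card_subtype_compl]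
      simp
    rw [← hc, ← Finset.card_univ]
    refine Finset.card_le_card_of_injOn
      (fun g x => if h : x = b then g ⟨a, hab⟩ else g ⟨x, h⟩) ?_ ?_
    · intro g _
      simpa using collisionPairs_extend hab g
    · intro g _ g' _ h
      ext ⟨x, hx⟩
      have := congrFun h x
      simp only [hx, dite_false] at this
      rw [this]

lemma choose_mul_descFactorial_le_card_collisionPairs (D R : ℕ) :
    D.choose 2 * R.descFactorial (D - 1) ≤
      (Finset.univ.filter (fun f : Fin D → Fin R => (collisionPairs f).card = 1)).card := by
  have hc : (Finset.univ.filter (fun s : Sym2 (Fin D) => ¬ s.IsDiag)).card = D.choose 2 := by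
    rw [← Fintype.card_subtype]
    convert Sym2.card_subtype_not_diag (α := Fin D)
    simp
  rw [← hc, ← smul_eq_mul]
  refine (Finset.card_nsmul_le_sum _ _ _ fun s hs =>
    descFactorial_le_card_collisionPairs_eq (Finset.mem_filter.mp hs).2).trans ?_
  rw [← Finset.card_biUnion]
  · refine Finset.card_le_card fun f hf => ?_
    obtain ⟨s, -, hs⟩ := Finset.mem_biUnion.mp hf
    simp [(Finset.mem_filter.mp hs).2]
  · intro s _ t _ hst
    refine Finset.disjoint_left.mpr fun f hf hf' => hst ?_
    exact Finset.singleton_injective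
      ((Finset.mem_filter.mp hf).2.symm.trans (Finset.mem_filter.mp hf').2)

lemma pow_mul_one_sub_le_descFactorial {R : ℕ} (k : ℕ) (hk : k + 1 ≤ R) :
    (R : ℝ) ^ (k + 1) * (1 - (k : ℝ) * (k + 1) / (2 * R)) ≤ (R.descFactorial (k + 1) : ℝ) := by
  induction k with
  | zero => simp
  | succ k ih =>
    have hR : (0 : ℝ) < R := by exact_mod_cast (by omega : 0 < R)
    have hk' : ((k : ℝ) + 1) ≤ R := by exact_mod_cast (by omega : k + 1 ≤ R)
    rw [Nat.descFactorial_succ R (k + 1), Nat.cast_mul, Nat.cast_sub (by omega)]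
    push_cast
    refine le_trans ?_ (mul_le_mul_of_nonneg_left (ih (by omega)) (sub_nonneg.mpr hk'))
    have h : (R - ((k : ℝ) + 1)) * (R ^ (k + 1) * (1 - (k : ℝ) * (k + 1) / (2 * R)))
        - R ^ (k + 1 + 1) * (1 - ((k : ℝ) + 1) * (k + 1 + 1) / (2 * R))
        = R ^ (k + 1) * ((k + 1) * ((k : ℝ) * (k + 1) / (2 * R))) := by
      field_simp
      ring
    have : (0 : ℝ) ≤ R ^ (k + 1) * ((k + 1) * ((k : ℝ) * (k + 1) / (2 * R))) := by positivity
    linarith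

/-- For `4 ≤ D ≤ R`, the probability (over a uniformly random `f : Fin D → Fin R`) that `f`
has exactly one collision pair is at least
`(D(D-1)/(2R)) ⬝ (1 - (D-2)/R) ⬝ (1 - (D-2)(D-3)/(2(R-1)))`. -/
theorem stmt_0 (D R : ℕ) (hD : 4 ≤ D) (hDR : D ≤ R) :
    (((Finset.univ : Finset (Fin D → Fin R)).filter
        (fun f => (collisionPairs f).card = 1)).card : ℝ)
      / (Fintype.card (Fin D → Fin R) : ℝ)
    ≥ ((D : ℝ) * ((D : ℝ) - 1) / (2 * (R : ℝ)))
        * (1 - ((D : ℝ) - 2) / (R : ℝ))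
        * (1 - ((D : ℝ) - 2) * ((D : ℝ) - 3) / (2 * ((R : ℝ) - 1))) := by
  have hcount := choose_mul_descFactorial_le_card_collisionPairs D R
  obtain ⟨m, rfl⟩ : ∃ m, D = m + 3 := ⟨D - 3, by omega⟩
  have hR : (4 : ℝ) ≤ R := by exact_mod_cast hD.trans hDR
  have hmR : (m : ℝ) + 3 ≤ R := by exact_mod_cast hDR
  have hdesc := pow_mul_one_sub_le_descFactorial m (show m + 1 ≤ R by omega)
  have hcount' := (Nat.cast_le (α := ℝ)).mpr hcount
  rw [show m + 3 - 1 = m + 1 + 1 from rfl, Nat.descFactorial_succ R (m + 1), Nat.cast_mul,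
    Nat.cast_mul, Nat.cast_sub (by omega), Nat.cast_choose_two] at hcount'
  have hfrac : 1 - (m : ℝ) * (m + 1) / (2 * (R - 1)) ≤ 1 - (m : ℝ) * (m + 1) / (2 * R) := by
    gcongr
    · linarith
    · linarith
  have hcard : (Fintype.card (Fin (m + 3) → Fin R) : ℝ) = (R : ℝ) ^ (m + 3) := by simp
  rw [ge_iff_le, hcard, le_div_iff₀ (by positivity)]
  refine le_trans ?_ hcount'
  push_cast
  have hsub : (0 : ℝ) ≤ R - (m + 1) := by linarith
  calc _ = ((m : ℝ) + 3) * (m + 3 - 1) / 2 * ((R - (m + 1)) *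
        (R ^ (m + 1) * (1 - (m : ℝ) * (m + 1) / (2 * (R - 1))))) := by
        have : (R : ℝ) - 1 ≠ 0 := by linarith
        field_simp
        ring
    _ ≤ _ := by
        have : (0 : ℝ) ≤ (m : ℝ) + 3 - 1 := by linarith [(Nat.cast_nonneg m : (0 : ℝ) ≤ m)]
        gcongr
        exact le_trans (by gcongr) hdesc
end

section
/- Let D be a natural number with D ≥ 32 and set R = 3D². If f : Fin D → Fin R is chosen uniformly at random from all functions, then the probability that f has exactly one collision pair is at least (5/36) · (1 − 1/D) · (1 − 1/(3D)). -/
open scoped Classical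

/-- If a property of functions does not depend on the value at `d`, then it is independent of the
event that `c` and `d` collide. -/
theorem card_filter_and_collision_mul {α β : Type*} [Fintype α] [DecidableEq α] [Fintype β] [DecidableEq β]
    (p : (α → β) → Prop) [DecidablePred p] {c d : α} (hcd : c ≠ d)
    (hp : ∀ f r, p (Function.update f d r) ↔ p f) :
    (Finset.univ.filter (fun f : α → β => p f ∧ f c = f d)).card * Fintype.card β
      = (Finset.univ.filter (fun f : α → β => p f)).card := by
  rw [← Finset.card_univ, ← Finset.card_product]
  refine Finset.card_bij' (fun x _ => Function.update x.1 d x.2)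
    (fun g _ => (Function.update g d (g c), g d)) ?_ ?_ ?_ ?_
  · rintro ⟨f, r⟩ h
    simp only [Finset.mem_product, Finset.mem_filter, Finset.mem_univ, true_and, and_true] at h ⊢
    exact (hp _ _).2 h.1
  · intro g h
    simp only [Finset.mem_product, Finset.mem_filter, Finset.mem_univ, true_and, and_true] at h ⊢
    exact ⟨(hp _ _).2 h, by simp [hcd]⟩
  · rintro ⟨f, r⟩ h
    simp only [Finset.mem_product, Finset.mem_filter, Finset.mem_univ, true_and, and_true] at h
    simp [hcd, h.2]
  · intro g _
    simp

theorem card_filter_isDiag_map_mul {α β : Type*} [Fintype α] [DecidableEq α] [Fintype β] [DecidableEq β]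
    {s : Sym2 α} (hs : ¬ s.IsDiag) :
    (Finset.univ.filter (fun f : α → β => (s.map f).IsDiag)).card * Fintype.card β
      = Fintype.card (α → β) := by
  induction s with | _ a b =>
  simpa using card_filter_and_collision_mul (fun _ : α → β => True) (c := a) (d := b)
    (by simpa using hs) (by simp)

theorem Sym2.exists_eq_mk_notMem {α : Type*} {s t : Sym2 α} (ht : ¬ t.IsDiag) (hst : s ≠ t) :
    ∃ c d, t = s(c, d) ∧ d ∉ s := by
  induction t with | _ c d =>
  by_cases hd : d ∈ s
  · refine ⟨d, c, Sym2.eq_swap, fun hc => hst ?_⟩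
    exact (Sym2.mem_and_mem_iff (by simpa using ht)).1 ⟨hc, hd⟩
  · exact ⟨c, d, rfl, hd⟩

theorem card_filter_isDiag_map_and_mul {α β : Type*} [Fintype α] [DecidableEq α] [Fintype β] [DecidableEq β]
    {s t : Sym2 α} (hs : ¬ s.IsDiag) (ht : ¬ t.IsDiag) (hst : s ≠ t) :
    (Finset.univ.filter (fun f : α → β => (s.map f).IsDiag ∧ (t.map f).IsDiag)).card
      * Fintype.card β ^ 2 = Fintype.card (α → β) := by
  obtain ⟨c, d, rfl, hd⟩ := Sym2.exists_eq_mk_notMem ht hst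
  have h := card_filter_and_collision_mul (β := β) (fun f : α → β => (s.map f).IsDiag)
    (c := c) (d := d) (by simpa using ht) (fun f r => by
      rw [Sym2.map_congr (g := f)]
      intro x hx
      exact Function.update_of_ne (ne_of_mem_of_not_mem hx hd) _ _)
  simp only [Sym2.map_mk, Sym2.mk_isDiag_iff]
  rw [← card_filter_isDiag_map_mul hs, ← h, pow_two, ← mul_assoc]

theorem card_collisionPairs_eq_sum {D R : ℕ} (f : Fin D → Fin R) :
    ((collisionPairs f).card : ℝ)
      = ∑ s : Sym2 (Fin D) with ¬ s.IsDiag, if (s.map f).IsDiag then (1 : ℝ) else 0 := by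
  rw [Finset.sum_boole, Finset.filter_filter, collisionPairs]

theorem sum_card_collisionPairs {D R : ℕ} (hR : 0 < R) :
    ∑ f : Fin D → Fin R, ((collisionPairs f).card : ℝ) = D.choose 2 * ((R : ℝ) ^ D / R) := by
  simp_rw [card_collisionPairs_eq_sum]
  rw [Finset.sum_comm, Finset.sum_congr rfl (g := fun _ => (R : ℝ) ^ D / R)]
  · rw [Finset.sum_const, nsmul_eq_mul, ← Fintype.card_subtype, Sym2.card_subtype_not_diag,
      Fintype.card_fin]
  · intro s hs
    rw [Finset.sum_boole, eq_div_iff (by positivity)]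
    have h := card_filter_isDiag_map_mul (β := Fin R) (Finset.mem_filter.1 hs).2
    simp only [Fintype.card_fin, Fintype.card_fun] at h
    exact_mod_cast h

theorem sum_card_collisionPairs_sq_le {D R : ℕ} (hR : 0 < R) :
    ∑ f : Fin D → Fin R, ((collisionPairs f).card : ℝ) ^ 2
      ≤ D.choose 2 * ((R : ℝ) ^ D / R) + (D.choose 2 : ℝ) ^ 2 * ((R : ℝ) ^ D / R ^ 2) := by
  set P : Finset (Sym2 (Fin D)) := Finset.univ.filter (fun s => ¬ s.IsDiag) with hP
  have hcard : P.card = D.choose 2 := by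
    rw [hP, ← Fintype.card_subtype, Sym2.card_subtype_not_diag, Fintype.card_fin]
  have hsq : ∀ f : Fin D → Fin R, ((collisionPairs f).card : ℝ) ^ 2
      = ∑ s ∈ P, ∑ t ∈ P, if (s.map f).IsDiag ∧ (t.map f).IsDiag then (1 : ℝ) else 0 := by
    intro f
    rw [card_collisionPairs_eq_sum, pow_two, Finset.sum_mul_sum]
    simp only [← ite_and, ite_mul, one_mul, zero_mul, hP]
  have hle : ∀ s ∈ P, ∀ t ∈ P,
      (∑ f : Fin D → Fin R, if (s.map f).IsDiag ∧ (t.map f).IsDiag then (1 : ℝ) else 0)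
        ≤ (if s = t then (R : ℝ) ^ D / R else 0) + (R : ℝ) ^ D / R ^ 2 := by
    intro s hs t ht
    rw [Finset.sum_boole]
    split_ifs with hst
    · subst hst
      have h := card_filter_isDiag_map_mul (β := Fin R) (Finset.mem_filter.1 hs).2
      simp only [Fintype.card_fin, Fintype.card_fun] at h
      simp only [and_self]
      refine le_add_of_le_of_nonneg (le_of_eq ?_) (by positivity)
      rw [eq_div_iff (by positivity)]
      exact_mod_cast h
    · have h := card_filter_isDiag_map_and_mul (β := Fin R) (Finset.mem_filter.1 hs).2
        (Finset.mem_filter.1 ht).2 hst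
      simp only [Fintype.card_fin, Fintype.card_fun] at h
      rw [zero_add]
      apply le_of_eq
      rw [eq_div_iff (by positivity)]
      exact_mod_cast h
  calc ∑ f : Fin D → Fin R, ((collisionPairs f).card : ℝ) ^ 2
      = ∑ s ∈ P, ∑ t ∈ P, ∑ f : Fin D → Fin R,
          if (s.map f).IsDiag ∧ (t.map f).IsDiag then (1 : ℝ) else 0 := by
        simp_rw [hsq]
        rw [Finset.sum_comm]
        exact Finset.sum_congr rfl fun s _ => Finset.sum_comm
    _ ≤ ∑ s ∈ P, ∑ t ∈ P, ((if s = t then (R : ℝ) ^ D / R else 0) + (R : ℝ) ^ D / R ^ 2) :=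
        Finset.sum_le_sum fun s hs => Finset.sum_le_sum fun t ht => hle s hs t ht
    _ = ∑ s ∈ P, ((R : ℝ) ^ D / R + D.choose 2 * ((R : ℝ) ^ D / R ^ 2)) := by
        refine Finset.sum_congr rfl fun s hs => ?_
        rw [Finset.sum_add_distrib, Finset.sum_ite_eq, if_pos hs, Finset.sum_const, hcard,
          nsmul_eq_mul]
    _ = _ := by
        rw [Finset.sum_const, hcard, nsmul_eq_mul]
        ring

/-- The second moment method: `X (2 - X) ≤ 1_{X = 1}` for natural numbers `X`. -/
theorem le_card_filter_collisionPairs_card_eq_one {D R : ℕ} (hR : 0 < R) :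
    (D.choose 2 / R : ℝ) * (1 - D.choose 2 / R) * (R : ℝ) ^ D
      ≤ ((Finset.univ.filter (fun f : Fin D → Fin R => (collisionPairs f).card = 1)).card : ℝ) := by
  have hpt : ∀ n : ℕ, 2 * (n : ℝ) - (n : ℝ) ^ 2 ≤ if n = 1 then 1 else 0 := by
    intro n
    split_ifs with h
    · subst h; norm_num
    · rcases Nat.eq_zero_or_pos n with rfl | hn
      · simp
      · have : (2 : ℝ) ≤ n := by exact_mod_cast (show 2 ≤ n by omega)
        nlinarith
  have hsum := Finset.sum_le_sum (s := Finset.univ)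
    fun (f : Fin D → Fin R) _ => hpt (collisionPairs f).card
  rw [Finset.sum_boole, Finset.sum_sub_distrib, ← Finset.mul_sum, sum_card_collisionPairs hR]
    at hsum
  have hsq := sum_card_collisionPairs_sq_le (D := D) hR
  have heq : (D.choose 2 / R : ℝ) * (1 - D.choose 2 / R) * (R : ℝ) ^ D
      = D.choose 2 * ((R : ℝ) ^ D / R) - (D.choose 2 : ℝ) ^ 2 * ((R : ℝ) ^ D / R ^ 2) := by
    ring
  linarith

/-- For `D ≥ 32` and `R = 3·D²`, the probability (over a uniformly random
`f : Fin D → Fin (3*D^2)`) that `f` has exactly one collision pair is at least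
`(5/36)·(1 - 1/D)·(1 - 1/(3D))`. -/
theorem stmt_1 (D : ℕ) (hD : 32 ≤ D) :
    (((Finset.univ : Finset (Fin D → Fin (3 * D ^ 2))).filter
        (fun f => (collisionPairs f).card = 1)).card : ℝ)
      / (Fintype.card (Fin D → Fin (3 * D ^ 2)) : ℝ)
    ≥ (5 / 36) * (1 - 1 / (D : ℝ)) * (1 - 1 / (3 * (D : ℝ))) := by
  have hD0 : (0 : ℝ) < D := by exact_mod_cast (show 0 < D by omega)
  have hR : 0 < 3 * D ^ 2 := by positivity
  have h := le_card_filter_collisionPairs_card_eq_one (D := D) hR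
  have hmean : (D.choose 2 : ℝ) / ((3 * D ^ 2 : ℕ) : ℝ) = (1 - 1 / (D : ℝ)) / 6 := by
    rw [Nat.cast_choose_two]
    push_cast
    field_simp
    ring
  rw [hmean] at h
  have hcard : (Fintype.card (Fin D → Fin (3 * D ^ 2)) : ℝ) = ((3 * D ^ 2 : ℕ) : ℝ) ^ D := by
    simp
  rw [ge_iff_le, hcard, le_div_iff₀ (by positivity)]
  refine le_trans (mul_le_mul_of_nonneg_right ?_ (by positivity)) h
  have hinv : 1 / (D : ℝ) ≤ 1 := by
    rw [div_le_one hD0]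
    exact_mod_cast (show 1 ≤ D by omega)
  have hpos : 0 < 1 / (D : ℝ) := by positivity
  have hthird : 1 / (3 * (D : ℝ)) = 1 / (D : ℝ) / 3 := by
    field_simp
  rw [hthird]
  nlinarith [mul_nonneg (sub_nonneg.2 hinv) hpos.le]
end
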